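/- Let k ≥ 1 be an integer, λ > 0, β ∈ (0,1), and define p_β^k(n,t) = ∑_{x ∈ Ω(k,n)} M_β^{(ζ(x))}(−kλt^β) · (λt^β)^{ζ(x)} / Π!(x). Then for every integer n ≥ 0 and every t > 0, the Caputo fractional derivative of order β of t ↦ p_β^k(n,t) satisfies (d^β/dt^β) p_β^k(n,t) = −kλ p_β^k(n,t) + λ ∑_{j=1}^{min(n,k)} p_β^k(n−j, t), with initial conditions p_β^k(0,0) = 1 and p_β^k(n,0) = 0 for n ≥ 1. -/

import Mathlib

open scoped BigOperators

/-- `Omega k n` is the (finite) set of tuples `(x₁,…,x_k)` of non-negative integers with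
`x₁ + 2·x₂ + ⋯ + k·x_k = n`. -/
def Omega (k n : ℕ) : Finset (Fin k → ℕ) :=
  (Fintype.piFinset fun _ => Finset.range (n + 1)).filter
    (fun x => ∑ i, (i.1 + 1) * x i = n)

/-- `ζ(x) = x₁ + ⋯ + x_k`. -/
def zeta {k : ℕ} (x : Fin k → ℕ) : ℕ := ∑ i, x i

/-- `Π!(x) = x₁! ⋯ x_k!`. -/
def pifact {k : ℕ} (x : Fin k → ℕ) : ℕ := ∏ i, (x i).factorial

/-- `c_k(n, y) = ∑_{x ∈ Ω(k,n)} y^{ζ(x)} / Π!(x)`. -/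
noncomputable def ck (k n : ℕ) (y : ℝ) : ℝ :=
  ∑ x ∈ Omega k n, y ^ zeta x / (pifact x : ℝ)

/-- The Mittag-Leffler function `M_β(z) = ∑_{m=0}^∞ z^m / Γ(βm + 1)`. -/
noncomputable def mittagLeffler (β z : ℝ) : ℝ :=
  ∑' m : ℕ, z ^ m / Real.Gamma (β * m + 1)

/-- The pmf of the time-fractional Poisson process of order `k`:
`p_β^k(n,t) = ∑_{x ∈ Ω(k,n)} M_β^{(ζ(x))}(−kλt^β) (λt^β)^{ζ(x)} / Π!(x)`. -/
noncomputable def pk (k : ℕ) (lam β : ℝ) (n : ℕ) (t : ℝ) : ℝ :=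
  ∑ x ∈ Omega k n,
    iteratedDeriv (zeta x) (mittagLeffler β) (-(k * lam * t ^ β)) *
      (lam * t ^ β) ^ zeta x / (pifact x : ℝ)

/-- The Caputo–Djrbashian fractional derivative of order `β ∈ (0,1)`:
`(d^β/dt^β) g(t) = (1/Γ(1−β)) ∫₀ᵗ g′(τ) (t−τ)^{−β} dτ`. -/
noncomputable def caputoDeriv (β : ℝ) (g : ℝ → ℝ) (t : ℝ) : ℝ :=
  (1 / Real.Gamma (1 - β)) * ∫ τ in (0 : ℝ)..t, deriv g τ * (t - τ) ^ (-β)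


def Ent (c : ℕ → ℝ) : Prop := ∀ R : ℝ, Summable fun m => c m * R ^ m

noncomputable def Sser (c : ℕ → ℝ) (z : ℝ) : ℝ := ∑' m, c m * z ^ m

def Dc (c : ℕ → ℝ) (m : ℕ) : ℝ := ((m : ℝ) + 1) * c (m + 1)

lemma Ent.D {c : ℕ → ℝ} (h : Ent c) : Ent (Dc c) := by
  intro R
  have h1 := ((summable_nat_add_iff 1).2 (h (2 * (|R| + 1)))).norm
  refine Summable.of_norm_bounded h1 fun m => ?_
  have e1 : ((m : ℝ) + 1) ≤ 2 ^ (m + 1) := by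
    have := (Nat.lt_two_pow_self (n := m + 1)).le
    exact_mod_cast this
  have e2 : |R| ^ m ≤ (|R| + 1) ^ (m + 1) := by
    calc |R| ^ m ≤ (|R| + 1) ^ m := by gcongr; linarith
      _ ≤ (|R| + 1) ^ (m + 1) := by
        apply pow_le_pow_right₀ _ (Nat.le_succ m)
        linarith [abs_nonneg R]
  have e3 : |(m : ℝ) + 1| = m + 1 := abs_of_nonneg (by positivity)
  simp only [Dc, Real.norm_eq_abs, abs_mul, abs_pow, e3, mul_pow]
  calc ((m : ℝ) + 1) * |c (m + 1)| * |R| ^ m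
      ≤ 2 ^ (m + 1) * |c (m + 1)| * (|R| + 1) ^ (m + 1) := by gcongr
    _ = _ := by simp [abs_of_nonneg (show 0 ≤ |R| + 1 by positivity)]; ring

lemma Ent.hasDerivAt {c : ℕ → ℝ} (h : Ent c) (y : ℝ) :
    HasDerivAt (Sser c) (Sser (Dc c) y) y := by
  have key : ∀ z, Summable fun m : ℕ => c m * (m * z ^ (m - 1)) := by
    intro z
    rw [← summable_nat_add_iff 1]
    refine (h.D z).congr fun m => ?_
    simp [Dc]; ring
  have := hasDerivAt_tsum_of_isPreconnected (𝕜 := ℝ) (F := ℝ) (α := ℕ)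
    (u := fun m => ‖c m * (m * (|y| + 1) ^ (m - 1))‖)
    (g := fun m z => c m * z ^ m) (g' := fun m z => c m * (m * z ^ (m - 1)))
    (t := Metric.ball 0 (|y| + 1)) (y₀ := 0) (y := y) (key _).norm
    Metric.isOpen_ball (convex_ball _ _).isPreconnected
    (fun n z _ => (hasDerivAt_pow n z).const_mul _) ?_ ?_ (h 0) ?_
  · have e : ∑' m : ℕ, c m * (m * y ^ (m - 1)) = Sser (Dc c) y := by
      rw [(key y).tsum_eq_zero_add]
      simp only [Sser, Dc]
      simp
      apply tsum_congr; intro m; ring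
    rw [← e]; exact this
  · intro n z hz
    have hz' : |z| ≤ |y| + 1 := by
      simpa using (mem_ball_zero_iff.1 hz).le
    simp only [norm_mul, norm_pow, Real.norm_eq_abs]
    have e4 : |(|y| + 1)| = (|y| + 1) := abs_of_nonneg (by positivity)
    rw [e4]
    gcongr
  · simp; positivity
  · simp

lemma Ent.iter {c : ℕ → ℝ} (h : Ent c) (j : ℕ) :
    Ent (Dc^[j] c) ∧ iteratedDeriv j (Sser c) = Sser (Dc^[j] c) := by
  induction j with
  | zero => exact ⟨h, by simp⟩
  | succ j ih =>
    rw [Function.iterate_succ_apply', iteratedDeriv_succ, ih.2]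
    exact ⟨ih.1.D, funext fun y => (ih.1.hasDerivAt y).deriv⟩

lemma Dc_iter (c : ℕ → ℝ) (j m : ℕ) :
    Dc^[j] c m = ((m + j).descFactorial j : ℝ) * c (m + j) := by
  induction j generalizing m with
  | zero => simp
  | succ j ih =>
    rw [Function.iterate_succ_apply', Dc, ih, Nat.descFactorial_succ]
    have : m + (j + 1) - j = m + 1 := by omega
    rw [this, show m + 1 + j = m + (j + 1) by ring]
    push_cast; ring

lemma Ent.hasSum_iter {c : ℕ → ℝ} (h : Ent c) (j : ℕ) (w u : ℝ) :
    HasSum (fun m => (m.descFactorial j : ℝ) * c m * w ^ (m - j) * u ^ m)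
      (iteratedDeriv j (Sser c) (w * u) * u ^ j) := by
  rw [(h.iter j).2, ← hasSum_nat_add_iff' j]
  have z : ∑ i ∈ Finset.range j, (i.descFactorial j : ℝ) * c i * w ^ (i - j) * u ^ i = 0 := by
    apply Finset.sum_eq_zero
    intro i hi
    rw [Nat.descFactorial_of_lt (Finset.mem_range.1 hi)]; simp
  rw [z, sub_zero]
  have := ((h.iter j).1 (w * u)).hasSum.mul_right (u ^ j)
  refine (congrArg (fun f : ℕ → ℝ => HasSum f _) (funext fun m => ?_)).mpr this
  rw [Dc_iter, Nat.add_sub_cancel, mul_pow, pow_add u]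
  ring

lemma Gamma_ratio {β x : ℝ} (h0 : 0 < β) (h1 : β < 1) (hx : 1 ≤ x) :
    (x + β - 1) ^ β * Real.Gamma x ≤ Real.Gamma (x + β) := by
  have hp : 0 < x + β - 1 := by linarith
  have := Real.Gamma_mul_add_mul_le_rpow_Gamma_mul_rpow_Gamma (s := x + β) (t := x + β - 1)
    (a := 1 - β) (b := β) (by linarith) hp (by linarith) h0 (by ring)
  rw [show (1 - β) * (x + β) + β * (x + β - 1) = x by ring] at this
  have g : Real.Gamma (x + β) = (x + β - 1) * Real.Gamma (x + β - 1) := by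
    rw [← Real.Gamma_add_one hp.ne']; ring_nf
  have G1 := Real.Gamma_pos_of_pos hp
  have G2 : 0 < Real.Gamma (x + β) := Real.Gamma_pos_of_pos (by linarith)
  calc (x + β - 1) ^ β * Real.Gamma x
      ≤ (x + β - 1) ^ β * (Real.Gamma (x + β) ^ (1 - β) * Real.Gamma (x + β - 1) ^ β) := by gcongr
    _ = Real.Gamma (x + β) ^ (1 - β) * ((x + β - 1) * Real.Gamma (x + β - 1)) ^ β := by
      rw [Real.mul_rpow hp.le G1.le]; ring
    _ = Real.Gamma (x + β) := by
      rw [← g, ← Real.rpow_add G2]; simp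

noncomputable def mlc (β : ℝ) (m : ℕ) : ℝ := 1 / Real.Gamma (β * m + 1)

lemma ent_mlc {β : ℝ} (h0 : 0 < β) (h1 : β < 1) : Ent (mlc β) := by
  intro R
  by_cases hR : R = 0
  · subst hR
    refine summable_of_ne_finset_zero (s := {0}) ?_
    intro b hb
    simp at hb; simp [hb]
  have gp : ∀ m : ℕ, 0 < Real.Gamma (β * m + 1) := fun m => Real.Gamma_pos_of_pos (by positivity)
  refine summable_of_ratio_test_tendsto_lt_one (l := 0) one_pos
    (Filter.Eventually.of_forall fun n => by simp [mlc, hR, (gp n).ne']) ?_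
  have T : Filter.Tendsto (fun m : ℕ => |R| * (β * m + β) ^ (-β)) Filter.atTop (nhds 0) := by
    rw [← mul_zero |R|]
    apply Filter.Tendsto.const_mul
    apply (tendsto_rpow_neg_atTop h0).comp
    apply Filter.tendsto_atTop_add_const_right
    exact tendsto_natCast_atTop_atTop.const_mul_atTop h0
  refine squeeze_zero (fun n => by positivity) (fun n => ?_) T
  have := Gamma_ratio h0 h1 (x := β * n + 1) (by nlinarith [Nat.cast_nonneg (α := ℝ) n])
  rw [show β * n + 1 + β - 1 = β * n + β by ring] at this
  have q : (0 : ℝ) < β * n + β := by positivity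
  rw [Real.rpow_neg q.le]
  have g1 := gp n
  have g2 := gp (n + 1)
  simp only [mlc, norm_mul, norm_pow, norm_div, Real.norm_eq_abs, abs_one, abs_of_pos g1, abs_of_pos g2]
  push_cast at g2 ⊢
  rw [show β * ((n : ℝ) + 1) + 1 = β * n + 1 + β by ring] at g2 ⊢
  have R0 : 0 < |R| := abs_pos.2 hR
  have q' : 0 < (β * (n : ℝ) + β) ^ β := Real.rpow_pos_of_pos q _
  rw [show 1 / Real.Gamma (β * n + 1 + β) * |R| ^ (n + 1) / (1 / Real.Gamma (β * n + 1) * |R| ^ n)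
    = |R| * (Real.Gamma (β * n + 1) / Real.Gamma (β * n + 1 + β)) by field_simp; ring]
  gcongr
  rw [div_le_iff₀ g2, inv_mul_eq_div, le_div_iff₀ q']
  linarith

lemma ml_eq (β : ℝ) : mittagLeffler β = Sser (mlc β) := by
  funext z
  simp only [mittagLeffler, Sser, mlc]
  apply tsum_congr; intro m; ring

lemma real_beta {s v t : ℝ} (hs : 0 < s) (hv : 0 < v) (ht : 0 < t) :
    ∫ τ in (0:ℝ)..t, τ ^ (s - 1) * (t - τ) ^ (v - 1)
      = t ^ (s + v - 1) * (Real.Gamma s * Real.Gamma v / Real.Gamma (s + v)) := by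
  have h := Complex.betaIntegral_scaled s v ht
  rw [Complex.betaIntegral_eq_Gamma_mul_div _ _ (by simpa) (by simpa)] at h
  have e : ∫ x in (0:ℝ)..t, (x : ℂ) ^ ((s : ℂ) - 1) * ((t : ℂ) - x) ^ ((v : ℂ) - 1)
      = ∫ x in (0:ℝ)..t, ((x ^ (s - 1) * (t - x) ^ (v - 1) : ℝ) : ℂ) := by
    apply intervalIntegral.integral_congr
    intro x hx
    rw [Set.uIcc_of_le ht.le] at hx
    simp only
    push_cast
    rw [Complex.ofReal_cpow hx.1, Complex.ofReal_cpow (by linarith [hx.2])]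
    push_cast; rfl
  rw [e, intervalIntegral.integral_ofReal] at h
  rw [← Complex.ofReal_inj, h]
  push_cast
  rw [Complex.ofReal_cpow ht.le, ← Complex.ofReal_add]
  simp only [Complex.Gamma_ofReal]
  push_cast; rfl

lemma real_beta_int {s v t : ℝ} (hs : 0 < s) (hv : 0 < v) (ht : 0 < t) :
    IntervalIntegrable (fun τ => τ ^ (s - 1) * (t - τ) ^ (v - 1)) MeasureTheory.volume 0 t := by
  by_contra hc
  have := real_beta hs hv ht
  rw [intervalIntegral.integral_undef hc] at this
  have g1 := Real.Gamma_pos_of_pos hs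
  have g2 := Real.Gamma_pos_of_pos hv
  have g3 := Real.Gamma_pos_of_pos (add_pos hs hv)
  have : 0 < t ^ (s + v - 1) * (Real.Gamma s * Real.Gamma v / Real.Gamma (s + v)) := by positivity
  linarith

lemma caputo_series {β : ℝ} (h0 : 0 < β) (h1 : β < 1) {B b : ℕ → ℝ} (hB : Ent B) (hb : Ent b)
    (hbB : ∀ m : ℕ, b m = B (m + 1) * Real.Gamma (β * (m + 1) + 1) / Real.Gamma (β * m + 1))
    {g : ℝ → ℝ} (hg : ∀ s, g s = Sser B (s ^ β)) {t : ℝ} (ht : 0 < t) :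
    caputoDeriv β g t = Sser b (t ^ β) := by
  have hg' : g = fun s => Sser B (s ^ β) := funext hg
  let K : ℕ → ℝ → ℝ := fun m τ => τ ^ (β * (m + 1) - 1) * (t - τ) ^ ((1 - β) - 1)
  let F : ℕ → ℝ → ℝ := fun m τ => (((m : ℝ) + 1) * B (m + 1) * β) * K m τ
  have hder : ∀ τ ∈ Set.Ioc 0 t, deriv g τ * (t - τ) ^ (-β) = ∑' m, F m τ := by
    intro τ hτ
    have d1 : HasDerivAt (fun s : ℝ => s ^ β) (β * τ ^ (β - 1)) τ :=
      Real.hasDerivAt_rpow_const (Or.inl hτ.1.ne')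
    have d2 := (hB.hasDerivAt (τ ^ β)).comp τ d1
    have d3 : deriv g τ = Sser (Dc B) (τ ^ β) * (β * τ ^ (β - 1)) := by
      rw [hg']; exact d2.deriv
    rw [d3, Sser, ← tsum_mul_right, ← tsum_mul_right]
    apply tsum_congr
    intro m
    simp only [F, K, Dc]
    rw [show β * ((m : ℝ) + 1) - 1 = β * m + (β - 1) by ring, Real.rpow_add hτ.1,
      Real.rpow_mul_natCast hτ.1.le, show 1 - β - 1 = -β by ring]
    ring
  have sp : ∀ m : ℕ, 0 < β * ((m : ℝ) + 1) := fun m => by positivity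
  have Kint : ∀ m, MeasureTheory.IntegrableOn (K m) (Set.Ioc 0 t) := fun m =>
    (intervalIntegrable_iff_integrableOn_Ioc_of_le ht.le).1
      (real_beta_int (sp m) (by linarith) ht)
  have Kval : ∀ m : ℕ, ∫ τ in Set.Ioc 0 t, K m τ = (t ^ β) ^ m *
      (Real.Gamma (β * (m + 1)) * Real.Gamma (1 - β) / Real.Gamma (β * m + 1)) := by
    intro m
    rw [← intervalIntegral.integral_of_le ht.le, real_beta (sp m) (by linarith) ht,
      ← Real.rpow_mul_natCast ht.le]
    ring_nf
  have Kpos : ∀ m, ∀ τ ∈ Set.Ioc 0 t, 0 ≤ K m τ := fun m τ hτ =>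
    mul_nonneg (Real.rpow_nonneg hτ.1.le _) (Real.rpow_nonneg (by linarith [hτ.2]) _)
  have cval : ∀ m : ℕ, (((m : ℝ) + 1) * B (m + 1) * β) * ((t ^ β) ^ m *
      (Real.Gamma (β * (m + 1)) * Real.Gamma (1 - β) / Real.Gamma (β * m + 1)))
      = b m * (t ^ β) ^ m * Real.Gamma (1 - β) := by
    intro m
    rw [hbB, Real.Gamma_add_one (sp m).ne']
    ring
  have Fval : ∀ m : ℕ, ∫ τ in Set.Ioc 0 t, F m τ = b m * (t ^ β) ^ m * Real.Gamma (1 - β) := by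
    intro m
    rw [MeasureTheory.integral_const_mul, Kval, cval]
  have Fnorm : ∀ m : ℕ, ∫ τ in Set.Ioc 0 t, ‖F m τ‖ = ‖b m * (t ^ β) ^ m * Real.Gamma (1 - β)‖ := by
    intro m
    rw [← cval, ← Kval, norm_mul, Real.norm_of_nonneg
      (MeasureTheory.setIntegral_nonneg measurableSet_Ioc (Kpos m)),
      ← MeasureTheory.integral_const_mul]
    apply MeasureTheory.setIntegral_congr_fun measurableSet_Ioc
    intro τ hτ
    simp only [F, norm_mul (_ * _ * β), Real.norm_of_nonneg (Kpos m τ hτ)]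
  have sb := (hb (t ^ β)).mul_right (Real.Gamma (1 - β))
  have H := MeasureTheory.hasSum_integral_of_summable_integral_norm
    (μ := MeasureTheory.volume.restrict (Set.Ioc 0 t)) (F := F)
    (fun m => (Kint m).const_mul _) (by simp only [Fnorm]; exact sb.norm)
  simp only [Fval] at H
  have H2 := ((hb (t ^ β)).hasSum.mul_right (Real.Gamma (1 - β))).unique H
  have gne : Real.Gamma (1 - β) ≠ 0 := (Real.Gamma_pos_of_pos (by linarith)).ne'
  rw [caputoDeriv, intervalIntegral.integral_of_le ht.le,
    MeasureTheory.setIntegral_congr_fun measurableSet_Ioc hder, ← H2, Sser]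
  field_simp

noncomputable def acoef (k m n : ℕ) : ℝ :=
  ∑ x ∈ Omega k n, (m.descFactorial (zeta x) : ℝ) * (-(k : ℝ)) ^ (m - zeta x) / (pifact x : ℝ)

lemma pk_hasSum {k : ℕ} {lam β : ℝ} (h0 : 0 < β) (h1 : β < 1) (n : ℕ) (v : ℝ) :
    HasSum (fun m => mlc β m * acoef k m n * (lam * v) ^ m)
      (∑ x ∈ Omega k n, iteratedDeriv (zeta x) (mittagLeffler β) (-(k * lam * v)) *
      (lam * v) ^ zeta x / (pifact x : ℝ)) := by
  have : ∀ x ∈ Omega k n, HasSum (fun m => ((m.descFactorial (zeta x) : ℝ) * mlc β m *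
      (-(k : ℝ)) ^ (m - zeta x) * (lam * v) ^ m) / (pifact x : ℝ))
      (iteratedDeriv (zeta x) (mittagLeffler β) (-(k * lam * v)) *
      (lam * v) ^ zeta x / (pifact x : ℝ)) := by
    intro x _
    have := ((ent_mlc h0 h1).hasSum_iter (zeta x) (-(k : ℝ)) (lam * v)).div_const (pifact x : ℝ)
    rw [← ml_eq, show -(k : ℝ) * (lam * v) = -(k * lam * v) by ring] at this
    exact this
  convert hasSum_sum this using 1
  funext m
  rw [acoef, Finset.mul_sum, Finset.sum_mul]
  apply Finset.sum_congr rfl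
  intro x _
  ring

lemma mem_Omega {k n : ℕ} {x : Fin k → ℕ} : x ∈ Omega k n ↔ ∑ i, (i.1 + 1) * x i = n := by
  simp only [Omega, Finset.mem_filter, Fintype.mem_piFinset, Finset.mem_range,
    and_iff_right_iff_imp]
  intro h i
  have : (i.1 + 1) * x i ≤ n := by
    rw [← h]
    exact Finset.single_le_sum (f := fun i : Fin k => (i.1 + 1) * x i) (fun _ _ => Nat.zero_le _)
      (Finset.mem_univ i)
  nlinarith [Nat.zero_le (i.1 * x i)]

lemma acoef_zero (k n : ℕ) : acoef k 0 n = if n = 0 then 1 else 0 := by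
  have z : ∀ x : Fin k → ℕ, x ≠ 0 → zeta x ≠ 0 := by
    intro x hx h
    apply hx
    funext i
    simpa using (Finset.sum_eq_zero_iff.1 h) i (Finset.mem_univ i)
  have z' : ∀ x : Fin k → ℕ, x ≠ 0 →
     ((0 : ℕ).descFactorial (zeta x) : ℝ) * (-(k : ℝ)) ^ (0 - zeta x) / (pifact x : ℝ) = 0 := by
    intro x hx
    rw [Nat.descFactorial_of_lt (Nat.pos_of_ne_zero (z x hx))]; simp
  split_ifs with h
  · subst h
    rw [acoef, Finset.sum_eq_single 0]
    · simp [zeta, pifact]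
    · intro x _ hx; exact z' x hx
    · intro h; exact absurd (mem_Omega.2 (by simp)) h
  · apply Finset.sum_eq_zero
    intro x hx
    apply z'
    rintro rfl
    rw [mem_Omega] at hx
    simp at hx; omega

lemma desc_rec (m j : ℕ) :
    (m + 1).descFactorial j = m.descFactorial j + j * m.descFactorial (j - 1) := by
  cases j with
  | zero => simp
  | succ j =>
    rw [Nat.succ_descFactorial_succ, Nat.descFactorial_succ]
    simp only [Nat.add_sub_cancel]
    rcases le_or_gt j m with h | h
    · rw [← add_mul]; congr 1; omega
    · simp [Nat.descFactorial_of_lt h]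

lemma shift_sum (k n : ℕ) (i : Fin k) (G : ℕ → ℝ) :
    ∑ x ∈ Omega k n, (x i : ℝ) * G (zeta x - 1) / (pifact x : ℝ)
      = if i.1 + 1 ≤ n then ∑ y ∈ Omega k (n - (i.1 + 1)), G (zeta y) / (pifact y : ℝ) else 0 := by
  classical
  have ups : ∀ (y : Fin k → ℕ), ∑ l : Fin k, (l.1 + 1) * (y + Pi.single i 1 : Fin k → ℕ) l
      = ∑ l : Fin k, (l.1 + 1) * y l + (i.1 + 1) := by
    intro y
    simp [mul_add, Finset.sum_add_distrib, Pi.single_apply]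
  have upz : ∀ (y : Fin k → ℕ), zeta (y + Pi.single i 1) = zeta y + 1 := by
    intro y
    simp [zeta, Finset.sum_add_distrib, Pi.single_apply]
  have upf : ∀ (y : Fin k → ℕ), pifact (y + Pi.single i 1) = pifact y * (y i + 1) := by
    intro y
    unfold pifact
    rw [← Finset.mul_prod_erase _ _ (Finset.mem_univ i),
      ← Finset.mul_prod_erase (a := i) _ (fun l => (y l).factorial) (Finset.mem_univ i)]
    have : ∏ l ∈ Finset.univ.erase i, ((y + Pi.single i 1 : Fin k → ℕ) l).factorial
        = ∏ l ∈ Finset.univ.erase i, (y l).factorial := by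
      apply Finset.prod_congr rfl
      intro l hl
      simp [Finset.ne_of_mem_erase hl]
    rw [this]
    simp [Nat.factorial_succ]; ring
  have dn : ∀ x : Fin k → ℕ, x i ≠ 0 → (x - Pi.single i 1) + Pi.single i 1 = x := by
    intro x hx
    funext l
    by_cases hl : l = i
    · subst hl; simp; omega
    · simp [hl]
  split_ifs with h
  · symm
    apply Finset.sum_of_injOn (fun y => y + Pi.single i 1)
    · intro a _ b _ hab; simpa using hab
    · intro y hy
      simp only [Finset.mem_coe, mem_Omega] at hy ⊢
      rw [ups, hy]; omega
    · intro x hx hx'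
      have : x i = 0 := by
        by_contra hc
        apply hx'
        refine ⟨x - Pi.single i 1, ?_, dn x hc⟩
        simp only [Finset.mem_coe, mem_Omega] at hx ⊢
        have := ups (x - Pi.single i 1)
        rw [dn x hc, hx] at this
        omega
      simp [this]
    · intro y _
      rw [upz, upf]
      have : (pifact y : ℝ) ≠ 0 := by
        unfold pifact; exact_mod_cast Finset.prod_ne_zero_iff.2 fun l _ => Nat.factorial_ne_zero _
      have : ((y i : ℝ) + 1) ≠ 0 := by positivity
      simp
      field_simp
  · apply Finset.sum_eq_zero
    intro x hx
    rw [mem_Omega] at hx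
    have : x i = 0 := by
      by_contra hc
      have := ups (x - Pi.single i 1)
      rw [dn x hc, hx] at this
      omega
    simp [this]

lemma acoef_succ (k m n : ℕ) : acoef k (m + 1) n
    = -(k : ℝ) * acoef k m n + ∑ j ∈ Finset.Icc 1 (min n k), acoef k m (n - j) := by
  have step : ∀ x ∈ Omega k n,
      ((m + 1).descFactorial (zeta x) : ℝ) * (-(k : ℝ)) ^ (m + 1 - zeta x) / (pifact x : ℝ)
      = -(k : ℝ) * ((m.descFactorial (zeta x) : ℝ) * (-(k : ℝ)) ^ (m - zeta x) / (pifact x : ℝ))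
        + ∑ i, (x i : ℝ) * ((m.descFactorial (zeta x - 1) : ℝ) * (-(k : ℝ)) ^ (m - (zeta x - 1)))
          / (pifact x : ℝ) := by
    intro x _
    rw [← Finset.sum_div, ← Finset.sum_mul, desc_rec]
    have hz : (∑ i, (x i : ℝ)) = (zeta x : ℝ) := by simp [zeta]
    rw [hz]
    push_cast
    have e1 : (m.descFactorial (zeta x) : ℝ) * (-(k : ℝ)) ^ (m + 1 - zeta x)
        = -(k : ℝ) * ((m.descFactorial (zeta x) : ℝ) * (-(k : ℝ)) ^ (m - zeta x)) := by
      rcases le_or_gt (zeta x) m with h | h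
      · rw [Nat.sub_add_comm h, pow_succ]; ring
      · simp [Nat.descFactorial_of_lt h]
    have e2 : (zeta x : ℝ) * (-(k : ℝ)) ^ (m + 1 - zeta x)
        = (zeta x : ℝ) * (-(k : ℝ)) ^ (m - (zeta x - 1)) := by
      rcases Nat.eq_zero_or_pos (zeta x) with h | h
      · simp [h]
      · rw [show m + 1 - zeta x = m - (zeta x - 1) by omega]
    rw [add_mul, e1, mul_right_comm, e2]
    ring
  rw [acoef, Finset.sum_congr rfl step, Finset.sum_add_distrib, ← Finset.mul_sum, Finset.sum_comm]
  congr 1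
  have := fun i : Fin k => shift_sum k n i
    (fun z => (m.descFactorial z : ℝ) * (-(k : ℝ)) ^ (m - z))
  simp only [this]
  change ∑ i : Fin k, (if i.1 + 1 ≤ n then acoef k m (n - (i.1 + 1)) else 0) = _
  rw [Fin.sum_univ_eq_sum_range (fun i => if i + 1 ≤ n then acoef k m (n - (i + 1)) else 0),
    ← Finset.sum_filter]
  refine Finset.sum_bij (fun i _ => i + 1) ?_ ?_ ?_ ?_
  · intro i hi
    simp at hi ⊢; omega
  · intro a _ b _ h; omega
  · intro b hb
    simp at hb
    exact ⟨b - 1, by simp; omega, by omega⟩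
  · intro i _; rfl

theorem governing_equation_time_fractional_poisson_of_order_k
    (k : ℕ) (hk : 1 ≤ k) (lam β : ℝ) (hlam : 0 < lam) (hβ : β ∈ Set.Ioo (0 : ℝ) 1) :
    (∀ (n : ℕ) (t : ℝ), 0 < t →
      caputoDeriv β (fun s => pk k lam β n s) t =
        -(k * lam) * pk k lam β n t +
          lam * ∑ j ∈ Finset.Icc 1 (min n k), pk k lam β (n - j) t) ∧
    pk k lam β 0 0 = 1 ∧ (∀ n : ℕ, 1 ≤ n → pk k lam β n 0 = 0) := by
  obtain ⟨h0, h1⟩ := hβ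
  have hs : ∀ n v, HasSum (fun m => (mlc β m * acoef k m n * lam ^ m) * v ^ m)
      (∑ x ∈ Omega k n, iteratedDeriv (zeta x) (mittagLeffler β) (-(k * lam * v)) *
      (lam * v) ^ zeta x / (pifact x : ℝ)) := by
    intro n v
    convert pk_hasSum (k := k) (lam := lam) h0 h1 n v using 1
    funext m; rw [mul_pow]; ring
  have hinit : ∀ n, pk k lam β n 0 = if n = 0 then 1 else 0 := by
    intro n
    have := hs n ((0 : ℝ) ^ β)
    have e : (0 : ℝ) ^ β = 0 := Real.zero_rpow h0.ne'
    have h2 : HasSum (fun m => (mlc β m * acoef k m n * lam ^ m) * ((0 : ℝ) ^ β) ^ m)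
      (mlc β 0 * acoef k 0 n) := by
      rw [e]
      convert hasSum_single (f := fun m => (mlc β m * acoef k m n * lam ^ m) * (0 : ℝ) ^ m) 0
        (fun m hm => by simp [hm]) using 1
      simp
    rw [pk, this.unique h2, acoef_zero]
    simp [mlc]
  refine ⟨?_, by simp [hinit], fun n hn => by rw [hinit, if_neg (by omega)]⟩
  intro n t ht
  have hrhs : ∀ v, HasSum (fun m => (mlc β m * acoef k (m + 1) n * lam ^ (m + 1)) * v ^ m)
      (-(k * lam) * (∑ x ∈ Omega k n, iteratedDeriv (zeta x) (mittagLeffler β) (-(k * lam * v)) *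
          (lam * v) ^ zeta x / (pifact x : ℝ)) +
        lam * ∑ j ∈ Finset.Icc 1 (min n k), (∑ x ∈ Omega k (n - j),
          iteratedDeriv (zeta x) (mittagLeffler β) (-(k * lam * v)) *
          (lam * v) ^ zeta x / (pifact x : ℝ))) := by
    intro v
    refine (congrArg (fun f : ℕ → ℝ => HasSum f _) (funext fun m => ?_)).mpr
      (((hs n v).mul_left (-(k * lam))).add ((hasSum_sum (s := Finset.Icc 1 (min n k))
      (fun j _ => hs (n - j) v)).mul_left lam))
    have : ∑ j ∈ Finset.Icc 1 (min n k), mlc β m * acoef k m (n - j) * lam ^ m * v ^ m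
        = mlc β m * (∑ j ∈ Finset.Icc 1 (min n k), acoef k m (n - j)) * lam ^ m * v ^ m := by
      rw [Finset.mul_sum, Finset.sum_mul, Finset.sum_mul]
    rw [this, acoef_succ]
    ring
  rw [caputo_series (g := fun s => pk k lam β n s) h0 h1 (fun v => (hs n v).summable)
    (fun v => (hrhs v).summable) ?_ (fun s => (hs n (s ^ β)).tsum_eq.symm) ht]
  · exact (hrhs (t ^ β)).tsum_eq
  · intro m
    have : Real.Gamma (β * (m + 1) + 1) ≠ 0 := (Real.Gamma_pos_of_pos (by positivity)).ne'
    simp only [mlc]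
    push_cast
    field_simp
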